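/- (Product criterion.) Let U ⊆ ℂ² be open and let f = f₁ + f₂j and g = g₁ + g₂j be hyperholomorphic quaternionic functions on U. Then the quaternionic product f*g, whose components are (f₁g₁ − f₂ḡ₂, f₁g₂ + f₂ḡ₁), is hyperholomorphic on U if and only if f and g satisfy on U the system of PDE: (f₁ − f̄₁)·∂g₁/∂z̄₁ − f₂·∂ḡ₂/∂z̄₁ − f̄₂·∂g₁/∂z₂ = 0 and (f₁ − f̄₁)·∂g₁/∂z̄₂ − f₂·∂ḡ₂/∂z̄₂ + f̄₂·∂g₁/∂z₁ = 0. -/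

import Mathlib

noncomputable section

open Complex

/-- Wirtinger derivative `∂f/∂z₁` of `f : ℂ × ℂ → ℂ` (as a real-differentiable map). -/
def dz1 (f : ℂ × ℂ → ℂ) (p : ℂ × ℂ) : ℂ :=
  (1 / 2 : ℂ) * (fderiv ℝ f p (1, 0) - Complex.I * fderiv ℝ f p (Complex.I, 0))

/-- Wirtinger derivative `∂f/∂z̄₁`. -/
def dz1c (f : ℂ × ℂ → ℂ) (p : ℂ × ℂ) : ℂ :=
  (1 / 2 : ℂ) * (fderiv ℝ f p (1, 0) + Complex.I * fderiv ℝ f p (Complex.I, 0))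

/-- Wirtinger derivative `∂f/∂z₂`. -/
def dz2 (f : ℂ × ℂ → ℂ) (p : ℂ × ℂ) : ℂ :=
  (1 / 2 : ℂ) * (fderiv ℝ f p (0, 1) - Complex.I * fderiv ℝ f p (0, Complex.I))

/-- Wirtinger derivative `∂f/∂z̄₂`. -/
def dz2c (f : ℂ × ℂ → ℂ) (p : ℂ × ℂ) : ℂ :=
  (1 / 2 : ℂ) * (fderiv ℝ f p (0, 1) + Complex.I * fderiv ℝ f p (0, Complex.I))

/-- Pointwise complex conjugate of a function. -/
def conjF (f : ℂ × ℂ → ℂ) : ℂ × ℂ → ℂ := fun p => (starRingEnd ℂ) (f p)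

/-- `f = f₁ + f₂·j` is hyperholomorphic on `U`:
`∂f₁/∂z̄₁ - ∂f̄₂/∂z₂ = 0` and `∂f₁/∂z̄₂ + ∂f̄₂/∂z₁ = 0` on `U`. -/
def Hyperholo (f₁ f₂ : ℂ × ℂ → ℂ) (U : Set (ℂ × ℂ)) : Prop :=
  ∀ p ∈ U, dz1c f₁ p - dz2 (conjF f₂) p = 0 ∧ dz2c f₁ p + dz1 (conjF f₂) p = 0

/-- `N = |f₁|² + |f₂|²`, the squared quaternionic norm of `f = f₁ + f₂ j`. -/
def invN (f₁ f₂ : ℂ × ℂ → ℂ) (p : ℂ × ℂ) : ℝ :=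
  Complex.normSq (f₁ p) + Complex.normSq (f₂ p)

/-- First component `f̄₁ / N` of the pointwise quaternionic (right) inverse of `f = f₁ + f₂ j`. -/
def inv1 (f₁ f₂ : ℂ × ℂ → ℂ) (p : ℂ × ℂ) : ℂ :=
  (starRingEnd ℂ) (f₁ p) / (invN f₁ f₂ p : ℂ)

/-- Second component `-f₂ / N` of the pointwise quaternionic (right) inverse of `f = f₁ + f₂ j`. -/
def inv2 (f₁ f₂ : ℂ × ℂ → ℂ) (p : ℂ × ℂ) : ℂ :=
  - f₂ p / (invN f₁ f₂ p : ℂ)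

theorem fderiv_conjF {f : ℂ × ℂ → ℂ} {p : ℂ × ℂ} (hf : DifferentiableAt ℝ f p) (v : ℂ × ℂ) :
    fderiv ℝ (conjF f) p v = (starRingEnd ℂ) (fderiv ℝ f p v) := by
  have h : HasFDerivAt (conjF f)
      ((Complex.conjCLE : ℂ →L[ℝ] ℂ).comp (fderiv ℝ f p)) p :=
    (Complex.conjCLE : ℂ →L[ℝ] ℂ).hasFDerivAt.comp p hf.hasFDerivAt
  rw [h.fderiv]
  simp

theorem differentiableAt_conjF {f : ℂ × ℂ → ℂ} {p : ℂ × ℂ} (hf : DifferentiableAt ℝ f p) :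
    DifferentiableAt ℝ (conjF f) p :=
  ((Complex.conjCLE : ℂ →L[ℝ] ℂ).hasFDerivAt.comp p hf.hasFDerivAt).differentiableAt

theorem fderiv_mul_sub {a b c d : ℂ × ℂ → ℂ} {p : ℂ × ℂ} (ha : DifferentiableAt ℝ a p)
    (hb : DifferentiableAt ℝ b p) (hc : DifferentiableAt ℝ c p) (hd : DifferentiableAt ℝ d p)
    (v : ℂ × ℂ) :
    fderiv ℝ (fun q => a q * b q - c q * conjF d q) p v =
      a p * fderiv ℝ b p v + b p * fderiv ℝ a p v
        - (c p * (starRingEnd ℂ) (fderiv ℝ d p v) + (starRingEnd ℂ) (d p) * fderiv ℝ c p v) := by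
  have h := ((ha.hasFDerivAt.mul hb.hasFDerivAt).sub
    (hc.hasFDerivAt.mul (differentiableAt_conjF hd).hasFDerivAt))
  have h2 : fderiv ℝ (fun q => a q * b q - c q * conjF d q) p = _ := h.fderiv
  rw [h2]
  simp [fderiv_conjF hd, conjF]

theorem fderiv_mul_add {a b c d : ℂ × ℂ → ℂ} {p : ℂ × ℂ} (ha : DifferentiableAt ℝ a p)
    (hb : DifferentiableAt ℝ b p) (hc : DifferentiableAt ℝ c p) (hd : DifferentiableAt ℝ d p)
    (v : ℂ × ℂ) :
    fderiv ℝ (conjF (fun q => a q * b q + c q * conjF d q)) p v =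
      (starRingEnd ℂ) (a p * fderiv ℝ b p v + b p * fderiv ℝ a p v
        + (c p * (starRingEnd ℂ) (fderiv ℝ d p v)
          + (starRingEnd ℂ) (d p) * fderiv ℝ c p v)) := by
  have h := ((ha.hasFDerivAt.mul hb.hasFDerivAt).add
    (hc.hasFDerivAt.mul (differentiableAt_conjF hd).hasFDerivAt))
  have h2 : fderiv ℝ (fun q => a q * b q + c q * conjF d q) p = _ := h.fderiv
  have h3 : DifferentiableAt ℝ (fun q => a q * b q + c q * conjF d q) p := h.differentiableAt
  rw [fderiv_conjF h3, h2]
  simp [fderiv_conjF hd, conjF]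

/-- product criterion: for `f, g` hyperholomorphic on `U`, the
quaternionic product `f*g`, with components `(f₁g₁ - f₂ḡ₂, f₁g₂ + f₂ḡ₁)`, is
hyperholomorphic on `U` iff
`(f₁ - f̄₁)∂g₁/∂z̄₁ - f₂ ∂ḡ₂/∂z̄₁ - f̄₂ ∂g₁/∂z₂ = 0` and
`(f₁ - f̄₁)∂g₁/∂z̄₂ - f₂ ∂ḡ₂/∂z̄₂ + f̄₂ ∂g₁/∂z₁ = 0` on `U`. -/
theorem product_hyperholo_criterion
    (U : Set (ℂ × ℂ)) (hU : IsOpen U) (f₁ f₂ g₁ g₂ : ℂ × ℂ → ℂ)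
    (hf₁ : ContDiffOn ℝ (⊤ : ℕ∞) f₁ U) (hf₂ : ContDiffOn ℝ (⊤ : ℕ∞) f₂ U)
    (hg₁ : ContDiffOn ℝ (⊤ : ℕ∞) g₁ U) (hg₂ : ContDiffOn ℝ (⊤ : ℕ∞) g₂ U)
    (hf : Hyperholo f₁ f₂ U) (hg : Hyperholo g₁ g₂ U) :
    Hyperholo (fun p => f₁ p * g₁ p - f₂ p * (starRingEnd ℂ) (g₂ p))
        (fun p => f₁ p * g₂ p + f₂ p * (starRingEnd ℂ) (g₁ p)) U ↔
      ∀ p ∈ U,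
        (f₁ p - (starRingEnd ℂ) (f₁ p)) * dz1c g₁ p
            - f₂ p * dz1c (conjF g₂) p
            - (starRingEnd ℂ) (f₂ p) * dz2 g₁ p = 0 ∧
        (f₁ p - (starRingEnd ℂ) (f₁ p)) * dz2c g₁ p
            - f₂ p * dz2c (conjF g₂) p
            + (starRingEnd ℂ) (f₂ p) * dz1 g₁ p = 0 := by
  refine forall₂_congr fun p hp => ?_
  have df₁ := (hf₁.contDiffAt (hU.mem_nhds hp)).differentiableAt (by simp)
  have df₂ := (hf₂.contDiffAt (hU.mem_nhds hp)).differentiableAt (by simp)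
  have dg₁ := (hg₁.contDiffAt (hU.mem_nhds hp)).differentiableAt (by simp)
  have dg₂ := (hg₂.contDiffAt (hU.mem_nhds hp)).differentiableAt (by simp)
  have e1 := fderiv_mul_sub df₁ dg₁ df₂ dg₂
  have e2 := fderiv_mul_add df₁ dg₂ df₂ dg₁
  simp only [show ∀ h q, conjF h q = (starRingEnd ℂ) (h q) from fun _ _ => rfl] at e1 e2
  obtain ⟨F1, F2⟩ := hf p hp
  obtain ⟨G1, G2⟩ := hg p hp
  have F1' := congrArg (starRingEnd ℂ) F1
  have F2' := congrArg (starRingEnd ℂ) F2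
  simp only [dz1, dz2, dz1c, dz2c, e1, e2, fderiv_conjF df₂, fderiv_conjF dg₂, map_add, map_sub,
    map_mul, Complex.conj_conj, Complex.conj_I, map_zero, map_one, map_div₀, map_ofNat]
    at F1 F2 F1' F2' G1 G2 ⊢
  refine and_congr (Eq.congr_left ?_) (Eq.congr_left ?_)
  · linear_combination g₁ p * F1 - (starRingEnd ℂ) (g₂ p) * F2' + (starRingEnd ℂ) (f₁ p) * G1
  · linear_combination g₁ p * F2 + (starRingEnd ℂ) (g₂ p) * F1' + (starRingEnd ℂ) (f₁ p) * G2
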